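/- Let (X,d) be a metric space, K ∈ ℝ, N < 0, and let f : X → (−∞,∞] be (K,N)-convex. Then for every K' ≤ K and every N' with N ≤ N' < 0, f is (K',N')-convex. -/

import Mathlib

open Real

/-- The comparison function `𝔰_κ`. -/
noncomputable def sk (κ θ : ℝ) : ℝ :=
  if 0 < κ then Real.sin (Real.sqrt κ * θ) / Real.sqrt κ
  else if κ = 0 then θ
  else Real.sinh (Real.sqrt (-κ) * θ) / Real.sqrt (-κ)

/-- The distortion coefficient `σ_κ^{(t)}(θ)`. -/
noncomputable def sg (κ t θ : ℝ) : ℝ := if θ = 0 then t else sk κ (t * θ) / sk κ θ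

/-- A minimal (constant-speed, minimizing) geodesic parametrized on `[0,1]`. -/
def IsMinGeodesic {X : Type*} [MetricSpace X] (γ : ℝ → X) : Prop :=
  ∀ s ∈ Set.Icc (0:ℝ) 1, ∀ t ∈ Set.Icc (0:ℝ) 1,
    dist (γ s) (γ t) = |s - t| * dist (γ 0) (γ 1)

/-- Exponential of an extended real, valued in `ℝ≥0∞`. -/
noncomputable def erexp (x : EReal) : ENNReal :=
  if x = ⊤ then ⊤ else if x = ⊥ then 0 else ENNReal.ofReal (Real.exp x.toReal)

/-- The function `f_N = exp(-f/N)`, valued in `ℝ≥0∞`. -/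
noncomputable def efN {X : Type*} (N : ℝ) (f : X → EReal) (x : X) : ENNReal :=
  erexp (f x * ((-1 / N : ℝ) : EReal))

/-- `(K,N)`-convexity for `N < 0` of a function `f : X → (-∞,∞]`. -/
def KNConvex {X : Type*} [MetricSpace X] (K N : ℝ) (f : X → EReal) : Prop :=
  ∀ x₀ x₁ : X, f x₀ ≠ ⊤ → f x₁ ≠ ⊤ →
    (K < 0 → dist x₀ x₁ < π * Real.sqrt (N / K)) →
    ∃ γ : ℝ → X, IsMinGeodesic γ ∧ γ 0 = x₀ ∧ γ 1 = x₁ ∧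
      ∀ t ∈ Set.Icc (0:ℝ) 1,
        efN N f (γ t) ≤ ENNReal.ofReal (sg (K / N) (1 - t) (dist x₀ x₁)) * efN N f x₀
          + ENNReal.ofReal (sg (K / N) t (dist x₀ x₁)) * efN N f x₁


lemma sturm_aux (h h1 h2 φ φ1 : ℝ → ℝ) (κ θ : ℝ)
    (hh : ∀ x ∈ Set.Icc 0 θ, HasDerivAt h (h1 x) x)
    (hh1 : ∀ x ∈ Set.Icc 0 θ, HasDerivAt h1 (h2 x) x)
    (hφ : ∀ x ∈ Set.Icc 0 θ, HasDerivAt φ (φ1 x) x)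
    (hφ1 : ∀ x ∈ Set.Icc 0 θ, HasDerivAt φ1 (-κ * φ x) x)
    (hpos : ∀ x ∈ Set.Icc 0 θ, 0 < φ x)
    (hineq : ∀ x ∈ Set.Icc 0 θ, 0 ≤ h2 x + κ * h x)
    (h0 : h 0 = 0) (hθ : h θ = 0) : ∀ x ∈ Set.Icc 0 θ, h x ≤ 0 := by
  intro c hc
  by_contra hcon
  push Not at hcon
  have hc0 : 0 < c := lt_of_le_of_ne hc.1 (by rintro rfl; linarith)
  have hcθ : c < θ := lt_of_le_of_ne hc.2 (by rintro rfl; linarith)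
  have hW : ∀ x ∈ Set.Icc 0 θ, HasDerivAt (fun x => h1 x * φ x - h x * φ1 x)
      ((h2 x + κ * h x) * φ x) x := by
    intro x hx
    have := ((hh1 x hx).mul (hφ x hx)).sub ((hh x hx).mul (hφ1 x hx))
    refine this.congr_deriv ?_
    ring
  have hg : ∀ x ∈ Set.Icc 0 θ, HasDerivAt (fun x => h x / φ x)
      ((h1 x * φ x - h x * φ1 x) / (φ x)^2) x := by
    intro x hx
    exact (hh x hx).div (hφ x hx) (hpos x hx).ne'
  have hmono : MonotoneOn (fun x => h1 x * φ x - h x * φ1 x) (Set.Icc 0 θ) := by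
    apply monotoneOn_of_deriv_nonneg (convex_Icc _ _)
    · exact fun x hx => (hW x hx).continuousAt.continuousWithinAt
    · intro x hx
      exact (hW x (interior_subset hx)).differentiableAt.differentiableWithinAt
    · intro x hx
      rw [(hW x (interior_subset hx)).deriv]
      exact mul_nonneg (hineq x (interior_subset hx)) (hpos x (interior_subset hx)).le
  have hgc : 0 < h c / φ c := div_pos hcon (hpos c hc)
  obtain ⟨c1, hc1, e1⟩ := exists_hasDerivAt_eq_slope (fun x => h x / φ x)
    (fun x => (h1 x * φ x - h x * φ1 x) / (φ x)^2) hc0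
    (fun x hx => (hg x ⟨hx.1, hx.2.trans hcθ.le⟩).continuousAt.continuousWithinAt)
    (fun x hx => hg x ⟨hx.1.le, hx.2.le.trans hcθ.le⟩)
  obtain ⟨c2, hc2, e2⟩ := exists_hasDerivAt_eq_slope (fun x => h x / φ x)
    (fun x => (h1 x * φ x - h x * φ1 x) / (φ x)^2) hcθ
    (fun x hx => (hg x ⟨hc0.le.trans hx.1, hx.2⟩).continuousAt.continuousWithinAt)
    (fun x hx => hg x ⟨hc0.le.trans hx.1.le, hx.2.le⟩)
  have m1 : c1 ∈ Set.Icc 0 θ := ⟨hc1.1.le, hc1.2.le.trans hcθ.le⟩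
  have m2 : c2 ∈ Set.Icc 0 θ := ⟨hc0.le.trans hc2.1.le, hc2.2.le⟩
  have hle := hmono m1 m2 (hc1.2.trans hc2.1).le
  simp only [h0, hθ, zero_div, sub_zero, zero_sub] at e1 e2 hle
  have p1 : 0 < (h1 c1 * φ c1 - h c1 * φ1 c1) / (φ c1)^2 := by
    rw [e1]; exact div_pos hgc hc0
  have p2 : (h1 c2 * φ c2 - h c2 * φ1 c2) / (φ c2)^2 < 0 := by
    rw [e2]; exact div_neg_of_neg_of_pos (by linarith) (by linarith)
  have q1 : 0 < h1 c1 * φ c1 - h c1 * φ1 c1 := by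
    by_contra hn
    push Not at hn
    exact absurd p1 (not_lt.mpr (div_nonpos_of_nonpos_of_nonneg hn (sq_nonneg _)))
  have q2 : h1 c2 * φ c2 - h c2 * φ1 c2 < 0 := by
    by_contra hn
    push Not at hn
    exact absurd p2 (not_lt.mpr (div_nonneg hn (sq_nonneg _)))
  linarith

noncomputable def ckk (κ θ : ℝ) : ℝ :=
  if 0 < κ then Real.cos (Real.sqrt κ * θ)
  else Real.cosh (Real.sqrt (-κ) * θ)

lemma sk_deriv (κ x : ℝ) : HasDerivAt (sk κ) (ckk κ x) x := by
  rcases lt_trichotomy κ 0 with h | h | h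
  · have e : sk κ = fun θ => Real.sinh (Real.sqrt (-κ) * θ) / Real.sqrt (-κ) := by
      funext θ; simp [sk, h.ne, h.not_gt]
    have hs : Real.sqrt (-κ) ≠ 0 := (Real.sqrt_pos.mpr (by linarith)).ne'
    rw [e]
    have := (((hasDerivAt_id x).const_mul (Real.sqrt (-κ))).sinh).div_const (Real.sqrt (-κ))
    refine this.congr_deriv ?_
    simp [ckk, h.not_gt]
    field_simp
  · subst h
    have e : sk 0 = fun θ => θ := by funext θ; simp [sk]
    rw [e]
    refine (hasDerivAt_id x).congr_deriv ?_
    simp [ckk]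
  · have e : sk κ = fun θ => Real.sin (Real.sqrt κ * θ) / Real.sqrt κ := by
      funext θ; simp [sk, h]
    have hs : Real.sqrt κ ≠ 0 := (Real.sqrt_pos.mpr h).ne'
    rw [e]
    have := (((hasDerivAt_id x).const_mul (Real.sqrt κ)).sin).div_const (Real.sqrt κ)
    refine this.congr_deriv ?_
    simp [ckk, h]
    field_simp

lemma ckk_deriv (κ x : ℝ) : HasDerivAt (ckk κ) (-κ * sk κ x) x := by
  rcases lt_or_ge 0 κ with h | h
  · have e : ckk κ = fun θ => Real.cos (Real.sqrt κ * θ) := by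
      funext θ; simp [ckk, h]
    have hs : Real.sqrt κ ≠ 0 := (Real.sqrt_pos.mpr h).ne'
    rw [e]
    have := (((hasDerivAt_id x).const_mul (Real.sqrt κ)).cos)
    refine this.congr_deriv ?_
    simp only [sk, h, if_true, id]
    field_simp
    rw [Real.sq_sqrt h.le]
    ring
  · have e : ckk κ = fun θ => Real.cosh (Real.sqrt (-κ) * θ) := by
      funext θ; simp [ckk, h.not_gt]
    rw [e]
    have := (((hasDerivAt_id x).const_mul (Real.sqrt (-κ))).cosh)
    refine this.congr_deriv ?_
    rcases h.eq_or_lt with h' | h'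
    · subst h'; simp
    have hs : Real.sqrt (-κ) ≠ 0 := (Real.sqrt_pos.mpr (by linarith)).ne'
    simp only [sk, h.not_gt, if_false, h'.ne, id]
    field_simp
    rw [Real.sq_sqrt (by linarith)]
    ring

lemma sk_zero (κ : ℝ) : sk κ 0 = 0 := by
  unfold sk; split_ifs <;> simp

lemma sk_pos (κ x : ℝ) (hx : 0 < x) (h : 0 < κ → Real.sqrt κ * x < π) : 0 < sk κ x := by
  unfold sk
  split_ifs with h1 h2
  · have := Real.sqrt_pos.mpr h1
    exact div_pos (Real.sin_pos_of_pos_of_lt_pi (by positivity) (h h1)) this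
  · exact hx
  · have : 0 < Real.sqrt (-κ) := Real.sqrt_pos.mpr (by
      rcases lt_trichotomy κ 0 with h | h | h
      · linarith
      · exact absurd h h2
      · exact absurd h h1)
    exact div_pos (Real.sinh_pos_iff.mpr (by positivity)) this

lemma sk_nonneg (κ x θ : ℝ) (hx : 0 ≤ x) (hxθ : x ≤ θ) (h : 0 < κ → Real.sqrt κ * θ < π) :
    0 ≤ sk κ x := by
  rcases hx.eq_or_lt with h0 | h0
  · rw [← h0, sk_zero]
  · exact (sk_pos κ x h0 fun hk =>
      (mul_le_mul_of_nonneg_left hxθ (Real.sqrt_nonneg _)).trans_lt (h hk)).le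

lemma ckk_pos (κ x θ : ℝ) (hx : x ∈ Set.Icc 0 θ) (h : 0 < κ → Real.sqrt κ * θ < π) :
    0 < ckk κ (x - θ / 2) := by
  unfold ckk
  split_ifs with h1
  · have h2 := Real.sqrt_pos.mpr h1
    have h3 := h h1
    have h4 := mul_nonneg h2.le hx.1
    have h5 := mul_le_mul_of_nonneg_left hx.2 h2.le
    apply Real.cos_pos_of_mem_Ioo
    constructor <;> nlinarith
  · exact Real.cosh_pos _

/-- The solution with given boundary values. -/
noncomputable def solw (κ θ a b x : ℝ) : ℝ := (sk κ (θ - x) * a + sk κ x * b) / sk κ θ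

noncomputable def solw1 (κ θ a b x : ℝ) : ℝ := (-ckk κ (θ - x) * a + ckk κ x * b) / sk κ θ

lemma solw_deriv (κ θ a b x : ℝ) : HasDerivAt (solw κ θ a b) (solw1 κ θ a b x) x := by
  have h1 : HasDerivAt (fun x => sk κ (θ - x)) (-ckk κ (θ - x)) x := by
    have := (sk_deriv κ (θ - x)).comp x ((hasDerivAt_id x).const_sub θ)
    refine this.congr_deriv ?_
    ring
  exact ((h1.mul_const a).add ((sk_deriv κ x).mul_const b)).div_const _

lemma solw1_deriv (κ θ a b x : ℝ) : HasDerivAt (solw1 κ θ a b) (-κ * solw κ θ a b x) x := by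
  have h1 : HasDerivAt (fun x => -ckk κ (θ - x)) (-κ * sk κ (θ - x)) x := by
    have := ((ckk_deriv κ (θ - x)).comp x ((hasDerivAt_id x).const_sub θ)).neg
    refine this.congr_deriv ?_
    ring
  refine (((h1.mul_const a).add ((ckk_deriv κ x).mul_const b)).div_const (sk κ θ)).congr_deriv ?_
  unfold solw
  ring

lemma solw_pos (κ θ a b x : ℝ) (hθ : 0 < θ) (h : 0 < κ → Real.sqrt κ * θ < π)
    (ha : 0 < a) (hb : 0 < b) (hx : x ∈ Set.Icc 0 θ) : 0 < solw κ θ a b x := by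
  have hp := sk_pos κ θ hθ h
  refine div_pos ?_ hp
  have n1 := sk_nonneg κ (θ - x) θ (by linarith [hx.2]) (by linarith [hx.1]) h
  have n2 := sk_nonneg κ x θ hx.1 hx.2 h
  rcases hx.1.eq_or_lt with h0 | h0
  · rw [← h0, sk_zero, sub_zero]; simp; positivity
  · have := sk_pos κ x h0 fun hk =>
      (mul_le_mul_of_nonneg_left hx.2 (Real.sqrt_nonneg _)).trans_lt (h hk)
    positivity

lemma key (κ κ' p θ a b : ℝ) (hp : 1 ≤ p) (hκ : p * κ ≤ κ') (hθ : 0 < θ)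
    (h : 0 < κ → Real.sqrt κ * θ < π) (h' : 0 < κ' → Real.sqrt κ' * θ < π)
    (ha : 0 < a) (hb : 0 < b) (x : ℝ) (hx : x ∈ Set.Icc 0 θ) :
    solw κ θ a b x ^ p ≤ solw κ' θ (a ^ p) (b ^ p) x := by
  have hpos := fun x hx => solw_pos κ θ a b x hθ h ha hb hx
  have s1 := (sk_pos κ θ hθ h).ne'
  have s2 := (sk_pos κ' θ hθ h').ne'
  have := sturm_aux (fun x => solw κ θ a b x ^ p - solw κ' θ (a ^ p) (b ^ p) x)
    (fun x => solw1 κ θ a b x * p * solw κ θ a b x ^ (p - 1) - solw1 κ' θ (a ^ p) (b ^ p) x)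
    (fun x => (-κ * solw κ θ a b x * p * solw κ θ a b x ^ (p - 1) +
      solw1 κ θ a b x * p * (solw1 κ θ a b x * (p - 1) * solw κ θ a b x ^ (p - 1 - 1)))
      - (-κ' * solw κ' θ (a ^ p) (b ^ p) x))
    (fun x => ckk κ' (x - θ / 2)) (fun x => -κ' * sk κ' (x - θ / 2)) κ' θ
    (fun x hx => ((solw_deriv κ θ a b x).rpow_const (Or.inl (hpos x hx).ne')).sub
      (solw_deriv κ' θ _ _ x))
    (fun x hx => (((solw1_deriv κ θ a b x).mul_const p).mul
      ((solw_deriv κ θ a b x).rpow_const (Or.inl (hpos x hx).ne'))).sub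
      (solw1_deriv κ' θ _ _ x))
    (fun x hx => by
      have := (ckk_deriv κ' (x - θ / 2)).comp x ((hasDerivAt_id x).sub_const (θ / 2))
      exact this.congr_deriv (by ring))
    (fun x hx => by
      have := ((sk_deriv κ' (x - θ / 2)).comp x ((hasDerivAt_id x).sub_const (θ / 2))).const_mul (-κ')
      exact this.congr_deriv (by ring))
    (fun x hx => ckk_pos κ' x θ hx h')
    (fun x hx => by
      have hu := hpos x hx
      have e : solw κ θ a b x ^ p = solw κ θ a b x ^ (p - 1) * solw κ θ a b x := by
        rw [← Real.rpow_add_one hu.ne']; ring_nf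
      have q1 : 0 ≤ (κ' - p * κ) * (solw κ θ a b x ^ (p - 1) * solw κ θ a b x) :=
        mul_nonneg (by linarith) (by positivity)
      have q2 : 0 ≤ p * (p - 1) * (solw1 κ θ a b x ^ 2 * solw κ θ a b x ^ (p - 1 - 1)) :=
        mul_nonneg (mul_nonneg (by linarith) (by linarith)) (by positivity)
      simp only [e]
      linarith)
    (by simp [solw, sk_zero, s1, s2])
    (by simp [solw, sk_zero, s1, s2]) x hx
  simpa using this

lemma key_sg (κ κ' p θ a b : ℝ) (hp : 1 ≤ p) (hκ : p * κ ≤ κ') (hθ : 0 < θ)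
    (h : 0 < κ → Real.sqrt κ * θ < π) (h' : 0 < κ' → Real.sqrt κ' * θ < π)
    (ha : 0 < a) (hb : 0 < b) (t : ℝ) (ht : t ∈ Set.Icc (0:ℝ) 1) :
    (sg κ (1 - t) θ * a + sg κ t θ * b) ^ p ≤ sg κ' (1 - t) θ * a ^ p + sg κ' t θ * b ^ p := by
  have e : ∀ κ a b, sg κ (1 - t) θ * a + sg κ t θ * b = solw κ θ a b (t * θ) := by
    intro κ a b
    simp only [sg, hθ.ne', if_false, solw]
    rw [show (1 - t) * θ = θ - t * θ by ring]
    ring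
  rw [e, e]
  exact key κ κ' p θ a b hp hκ hθ h h' ha hb _
    ⟨mul_nonneg ht.1 hθ.le, mul_le_of_le_one_left hθ.le ht.2⟩

lemma sg_nonneg (κ θ : ℝ) (hθ : 0 ≤ θ) (h : 0 < κ → Real.sqrt κ * θ < π)
    (t : ℝ) (ht : t ∈ Set.Icc (0:ℝ) 1) : 0 ≤ sg κ t θ := by
  unfold sg
  split_ifs with h0
  · exact ht.1
  · exact div_nonneg (sk_nonneg κ _ θ (mul_nonneg ht.1 hθ) (mul_le_of_le_one_left hθ ht.2) h)
      (sk_nonneg κ _ θ hθ le_rfl h)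

lemma efN_real {X : Type*} (N : ℝ) (f : X → EReal) (x : X) (r : ℝ) (h : f x = r) :
    efN N f x = ENNReal.ofReal (Real.exp (r * (-1 / N))) := by
  unfold efN erexp
  rw [h, ← EReal.coe_mul]
  simp only [EReal.coe_ne_top, EReal.coe_ne_bot, if_false, EReal.toReal_coe]

lemma efN_top {X : Type*} (N : ℝ) (hN : N < 0) (f : X → EReal) (x : X) (h : f x = ⊤) :
    efN N f x = ⊤ := by
  unfold efN erexp
  rw [h, EReal.top_mul_coe_of_pos (div_pos_of_neg_of_neg (by norm_num) hN)]
  simp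

lemma dom_aux (K N θ : ℝ) (hN : N < 0) (h : K < 0 → θ < π * Real.sqrt (N / K)) :
    0 < K / N → Real.sqrt (K / N) * θ < π := by
  intro hk
  have hK : K < 0 := by
    by_contra hn
    push Not at hn
    exact absurd hk (not_lt.mpr (div_nonpos_of_nonneg_of_nonpos hn hN.le))
  have h1 := h hK
  have h2 := Real.sqrt_pos.mpr hk
  have e : Real.sqrt (K / N) * Real.sqrt (N / K) = 1 := by
    rw [← Real.sqrt_mul hk.le, div_mul_div_cancel₀ hN.ne, div_self hK.ne, Real.sqrt_one]
  calc _ < Real.sqrt (K / N) * (π * Real.sqrt (N / K)) := mul_lt_mul_of_pos_left h1 h2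
    _ = π * (Real.sqrt (K / N) * Real.sqrt (N / K)) := by ring
    _ = π := by rw [e, mul_one]

theorem stmt_7 {X : Type*} [MetricSpace X] (K N : ℝ) (hN : N < 0)
    (f : X → EReal) (hbot : ∀ x, f x ≠ ⊥) (hf : KNConvex K N f) :
    ∀ K' N' : ℝ, K' ≤ K → N ≤ N' → N' < 0 → KNConvex K' N' f := by
  intro K' N' hK hNN hN' x₀ x₁ hx₀ hx₁ hd
  have hd' : K < 0 → dist x₀ x₁ < π * Real.sqrt (N / K) := by
    intro hK0
    have hK0' : K' < 0 := by linarith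
    refine (hd hK0').trans_le (mul_le_mul_of_nonneg_left (Real.sqrt_le_sqrt ?_) Real.pi_pos.le)
    rw [← neg_div_neg_eq, ← neg_div_neg_eq N K]
    exact div_le_div₀ (by linarith) (by linarith) (by linarith) (by linarith)
  obtain ⟨γ, hγ, hγ0, hγ1, H⟩ := hf x₀ x₁ hx₀ hx₁ hd'
  refine ⟨γ, hγ, hγ0, hγ1, fun t ht => ?_⟩
  have ht' : 1 - t ∈ Set.Icc (0:ℝ) 1 := ⟨by linarith [ht.2], by linarith [ht.1]⟩
  have Ht := H t ht
  have D := dom_aux K N _ hN hd'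
  have D' := dom_aux K' N' _ hN' hd
  obtain ⟨r0, e0⟩ : ∃ r : ℝ, f x₀ = r := ⟨_, (EReal.coe_toReal hx₀ (hbot _)).symm⟩
  obtain ⟨r1, e1⟩ : ∃ r : ℝ, f x₁ = r := ⟨_, (EReal.coe_toReal hx₁ (hbot _)).symm⟩
  have n0 := sg_nonneg _ _ dist_nonneg D _ ht'
  have n1 := sg_nonneg _ _ dist_nonneg D _ ht
  have n0' := sg_nonneg _ _ dist_nonneg D' _ ht'
  have n1' := sg_nonneg _ _ dist_nonneg D' _ ht
  rw [efN_real N f _ _ e0, efN_real N f _ _ e1, ← ENNReal.ofReal_mul n0, ← ENNReal.ofReal_mul n1,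
    ← ENNReal.ofReal_add (by positivity) (by positivity)] at Ht
  rw [efN_real N' f _ _ e0, efN_real N' f _ _ e1, ← ENNReal.ofReal_mul n0',
    ← ENNReal.ofReal_mul n1', ← ENNReal.ofReal_add (by positivity) (by positivity)]
  have hγt : f (γ t) ≠ ⊤ := by
    intro htop
    rw [efN_top N hN f _ htop] at Ht
    exact absurd Ht (not_le.mpr ENNReal.ofReal_lt_top)
  obtain ⟨r, e⟩ : ∃ r : ℝ, f (γ t) = r := ⟨_, (EReal.coe_toReal hγt (hbot _)).symm⟩
  rw [efN_real N f _ _ e, ENNReal.ofReal_le_ofReal_iff (by positivity)] at Ht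
  rw [efN_real N' f _ _ e]
  apply ENNReal.ofReal_le_ofReal
  have hp : 1 ≤ N / N' := by rw [one_le_div_of_neg hN']; exact hNN
  have ex : ∀ r : ℝ, Real.exp (r * (-1 / N')) = Real.exp (r * (-1 / N)) ^ (N / N') := by
    intro r
    rw [← Real.exp_mul]
    congr 1
    have := hN.ne
    have := hN'.ne
    field_simp
  rw [ex r, ex r0, ex r1]
  refine (Real.rpow_le_rpow (Real.exp_pos _).le Ht (by linarith)).trans ?_
  rcases (dist_nonneg (x := x₀) (y := x₁)).eq_or_lt with h0 | h0
  · have hx : x₀ = x₁ := dist_eq_zero.mp h0.symm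
    have hr : r0 = r1 := by
      rw [hx, e1] at e0; exact (EReal.coe_injective e0).symm
    subst hr
    simp only [sg, ← h0, if_true]
    rw [← add_mul, ← add_mul]
    simp
  · refine key_sg _ _ _ _ _ _ hp ?_ h0 D D' (Real.exp_pos _) (Real.exp_pos _) t ht
    have : N / N' * (K / N) = K / N' := by
      have := hN.ne
      have := hN'.ne
      field_simp
    rw [this]
    exact div_le_div_of_nonpos_of_le hN'.le hK
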